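/- arXiv:2507.17199 — 2 statements merged into one kernel-verified Lean document; each statement's English description precedes it below -/
import Mathlib

section
/- Let 𝔽 be a field, t ≥ 2 an integer, x_1, …, x_{t−1} distinct nonzero elements of 𝔽, and y_1, …, y_{t−1} ∈ 𝔽. Then the map sending each secret s ∈ 𝔽 to the unique polynomial f of degree strictly less than t with f(0) = s and f(x_i) = y_i for all i is a bijection between 𝔽 and the set of all polynomials of degree strictly less than t interpolating the data (x_i, y_i). Consequently, for any two secrets s, s' ∈ 𝔽, the number of sharing polynomials of degree strictly less than t consistent with the given t − 1 shares and secret s equals the number consistent with those shares and secret s'. -/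
open Polynomial

/-- Given `t ≥ 2`, distinct nonzero points `x₁, …, x_{t-1}` and values
`y₁, …, y_{t-1}` over a field `𝔽`, the map sending each secret `s` to the unique
polynomial of degree `< t` with `f(0) = s` interpolating the data `(xᵢ, yᵢ)` is a
bijection between `𝔽` and the set of all polynomials of degree `< t` that
interpolate the data.  Consequently, for any two secrets `s, s'`, the number of
sharing polynomials of degree `< t` consistent with the given `t - 1` shares and
secret `s` equals the number consistent with those shares and secret `s'`. -/
theorem shamir_secret_bijection {F : Type*} [Field F] (t : ℕ) (ht : 2 ≤ t)
    (x : Fin (t - 1) → F) (hinj : Function.Injective x) (hx : ∀ i, x i ≠ 0)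
    (y : Fin (t - 1) → F) :
    (∃ φ : F → Polynomial F,
        (∀ s : F, (φ s).degree < (t : ℕ) ∧ (φ s).eval 0 = s ∧
          ∀ i, (φ s).eval (x i) = y i) ∧
        Set.BijOn φ Set.univ
          {f : Polynomial F | f.degree < (t : ℕ) ∧ ∀ i, f.eval (x i) = y i}) ∧
    ∀ s s' : F,
      Nat.card {f : Polynomial F //
          f.degree < (t : ℕ) ∧ f.eval 0 = s ∧ ∀ i, f.eval (x i) = y i} =
      Nat.card {f : Polynomial F //
          f.degree < (t : ℕ) ∧ f.eval 0 = s' ∧ ∀ i, f.eval (x i) = y i} := by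
  classical
  let v : Option (Fin (t - 1)) → F := fun o => o.elim 0 x
  have hv : Set.InjOn v (Finset.univ : Finset (Option (Fin (t - 1)))) := by
    rintro (_ | i) _ (_ | j) _ h
    · rfl
    · exact absurd h.symm (hx j)
    · exact absurd h (hx i)
    · exact congrArg some (hinj h)
  have hc : (Finset.univ : Finset (Option (Fin (t - 1)))).card = t := by
    simp only [Finset.card_univ, Fintype.card_option, Fintype.card_fin]
    omega
  have huniq : ∀ f g : Polynomial F, f.degree < (t : ℕ) → g.degree < (t : ℕ) →
      f.eval 0 = g.eval 0 → (∀ i, f.eval (x i) = y i) → (∀ i, g.eval (x i) = y i) → f = g := by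
    intro f g hf hg h0 h1 h2
    refine Polynomial.eq_of_degrees_lt_of_eval_index_eq Finset.univ hv
      (by rw [hc]; exact hf) (by rw [hc]; exact hg) ?_
    rintro (_ | i) _
    · exact h0
    · exact (h1 i).trans (h2 i).symm
  let φ : F → Polynomial F := fun s =>
    Lagrange.interpolate Finset.univ v (fun o => o.elim s y)
  have hφ : ∀ s : F, (φ s).degree < (t : ℕ) ∧ (φ s).eval 0 = s ∧
      ∀ i, (φ s).eval (x i) = y i := by
    intro s
    refine ⟨?_, ?_, fun i => ?_⟩
    · have := Lagrange.degree_interpolate_lt (fun o : Option (Fin (t - 1)) => o.elim s y) hv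
      rwa [hc] at this
    · exact Lagrange.eval_interpolate_at_node (fun o : Option (Fin (t - 1)) => o.elim s y) hv
        (Finset.mem_univ none)
    · exact Lagrange.eval_interpolate_at_node (fun o : Option (Fin (t - 1)) => o.elim s y) hv
        (Finset.mem_univ (some i))
  refine ⟨⟨φ, hφ, fun s _ => ⟨(hφ s).1, (hφ s).2.2⟩, ?_, ?_⟩, ?_⟩
  · intro a _ b _ h
    rw [← (hφ a).2.1, h, (hφ b).2.1]
  · rintro f ⟨hf, hfy⟩
    exact ⟨f.eval 0, trivial, huniq _ _ (hφ _).1 hf (hφ _).2.1 (hφ _).2.2 hfy⟩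
  · have key : ∀ s : F, Nat.card {f : Polynomial F //
        f.degree < (t : ℕ) ∧ f.eval 0 = s ∧ ∀ i, f.eval (x i) = y i} = 1 := by
      intro s
      rw [Nat.card_eq_one_iff_unique]
      refine ⟨⟨?_⟩, ⟨⟨φ s, hφ s⟩⟩⟩
      rintro ⟨f, hf⟩ ⟨g, hg⟩
      exact Subtype.ext (huniq f g hf.1 hg.1 (hf.2.1.trans hg.2.1.symm) hf.2.2 hg.2.2)
    intro s s'
    rw [key s, key s']
end

section
/- Let 𝔽 be a field, t ≥ 2 an integer, s ∈ 𝔽 a fixed secret, and x_1, …, x_{t−1} distinct nonzero elements of 𝔽. Then the map from 𝔽^{t−1} to 𝔽^{t−1} sending a coefficient vector (a_1, …, a_{t−1}) to the share vector (f(x_1), …, f(x_{t−1})), where f(X) = s + a_1 X + ⋯ + a_{t−1} X^{t−1}, is a bijection. Hence, when the non-constant coefficients are chosen uniformly at random, the joint distribution of any t − 1 shares is uniform on 𝔽^{t−1} and is independent of the secret s. -/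
open Polynomial

/-- The map sending a vector of non-constant coefficients `(a₁, …, a_{t-1})` to the
vector of shares `(f(x₁), …, f(x_{t-1}))`, where
`f(X) = s + a₁ X + ⋯ + a_{t-1} X^{t-1}`. -/
noncomputable def shamirShareMap {F : Type*} [Field F] (t : ℕ) (s : F)
    (x : Fin (t - 1) → F) (a : Fin (t - 1) → F) : Fin (t - 1) → F :=
  fun i =>
    (Polynomial.C s + ∑ j : Fin (t - 1), Polynomial.C (a j) * Polynomial.X ^ ((j : ℕ) + 1)).eval
      (x i)

/-- For a fixed secret `s` and distinct nonzero points `x₁, …, x_{t-1}`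
(`t ≥ 2`), the coefficients-to-shares map `(a₁, …, a_{t-1}) ↦ (f(x₁), …, f(x_{t-1}))`
with `f(X) = s + a₁ X + ⋯ + a_{t-1} X^{t-1}` is a bijection of `𝔽^{t-1}`.  Hence, when
the non-constant coefficients are chosen uniformly at random, the joint distribution
of the `t - 1` shares is uniform on `𝔽^{t-1}`, independently of the secret `s`. -/
theorem shamir_share_map_bijective {F : Type*} [Field F] [Fintype F] [DecidableEq F]
    (t : ℕ) (ht : 2 ≤ t) (s : F)
    (x : Fin (t - 1) → F) (hinj : Function.Injective x) (hx : ∀ i, x i ≠ 0) :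
    Function.Bijective (shamirShareMap t s x) ∧
      PMF.map (shamirShareMap t s x) (PMF.uniformOfFintype (Fin (t - 1) → F)) =
        PMF.uniformOfFintype (Fin (t - 1) → F) := by
  have hi : Function.Injective (shamirShareMap t s x) := by
    intro a b hab
    have h0 : a - b = 0 := by
      apply Matrix.eq_zero_of_forall_index_sum_mul_pow_eq_zero hinj
      intro i
      have h := congrFun hab i
      simp only [shamirShareMap, eval_add, eval_C, eval_finset_sum, eval_mul, eval_pow,
        eval_X, add_right_inj] at h
      apply mul_left_cancel₀ (hx i)
      rw [mul_zero, Finset.mul_sum]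
      rw [← sub_eq_zero, ← Finset.sum_sub_distrib] at h
      rw [← h]
      apply Finset.sum_congr rfl
      intro j _
      simp only [Pi.sub_apply]
      ring
    exact sub_eq_zero.mp h0
  have hb : Function.Bijective (shamirShareMap t s x) := Finite.injective_iff_bijective.mp hi
  refine ⟨hb, ?_⟩
  ext y
  obtain ⟨a, rfl⟩ := hb.2 y
  rw [PMF.map_apply, tsum_eq_single a]
  · simp
  · intro b hne
    rw [if_neg]
    intro h
    exact hne (hi h.symm)
end
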